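/- Let N ≥ 2 be even, and let A1 and A12 be real n×n matrices. Then I_N ⊗ A1 + Γ_D ⊗ A12 is Hurwitz if and only if the matrices A1, A1 − 2·A12, A1 − 4·A12, …, A1 − (N−2)·A12 and A1 − N·A12 (i.e., A1 − m·A12 for m = 0 and every even m with 2 ≤ m ≤ N) are all Hurwitz. -/

import Mathlib

open Matrix Kronecker

/-- A real square matrix is Hurwitz (stable) if every eigenvalue over `ℂ` has negative
real part. -/
def IsHurwitz {ι : Type*} [Fintype ι] [DecidableEq ι] (M : Matrix ι ι ℝ) : Prop :=
  ∀ μ ∈ spectrum ℂ (M.map Complex.ofReal), μ.re < 0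

/-- Off-diagonal entries of the diffusive coupling matrix `Γ_D` (1-indexed: `γ_{ij} = −1` if
`i > j`, `j ≤ i−2` and `j` is odd; `γ_{ij} = 1` for all other `i ≠ j`). Indices 0-based here. -/
def GamDOff (N : ℕ) (i j : Fin N) : ℝ :=
  if j.1 + 2 ≤ i.1 ∧ j.1 % 2 = 0 then -1 else 1

/-- The diffusive coupling matrix `Γ_D`: off-diagonal entries as in `GamDOff`, and diagonal
entries `γ_{ii} = −∑_{j ≠ i} γ_{ij}`, so every row sums to zero. -/
def GamD (N : ℕ) : Matrix (Fin N) (Fin N) ℝ :=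
  Matrix.of fun i j =>
    if i = j then -(∑ k ∈ Finset.univ \ {i}, GamDOff N i k) else GamDOff N i j

/-- The determinant of `1 ⊗ B + T ⊗ C` for `T` triangular along an ordering of its indices. -/
theorem det_one_kronecker_add_kronecker_of_blockTriangular {R ι α κ : Type*} [CommRing R]
    [Fintype ι] [DecidableEq ι] [Fintype α] [LinearOrder α] [Fintype κ] [DecidableEq κ]
    (b : ι ≃ α) {T : Matrix ι ι R} (hT : T.BlockTriangular b) (B C : Matrix κ κ R) :
    ((1 : Matrix ι ι R) ⊗ₖ B + T ⊗ₖ C).det = ∏ i, (B + T i i • C).det := by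
  have hM : ((1 : Matrix ι ι R) ⊗ₖ B + T ⊗ₖ C).BlockTriangular (fun p : ι × κ => b p.1) := by
    rintro ⟨i, x⟩ ⟨j, y⟩ hij
    have hne : i ≠ j := by
      rintro rfl
      exact lt_irrefl _ hij
    simp [hT hij, hne]
  rw [hM.det_fintype, ← b.prod_comp]
  refine Finset.prod_congr rfl fun i _ => ?_
  let e : κ ≃ {p : ι × κ // b p.1 = b i} :=
    { toFun := fun x => ⟨(i, x), rfl⟩
      invFun := fun p => p.1.2
      left_inv := fun _ => rfl
      right_inv := by
        rintro ⟨⟨j, y⟩, h⟩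
        obtain rfl := b.injective h
        rfl }
  rw [← det_submatrix_equiv_self e]
  congr 1
  ext x y
  simp [e, toSquareBlock_def]

/-- Replacing `G` by a similar matrix `T` does not change the determinant of
`1 ⊗ B + G ⊗ C`. -/
theorem det_one_kronecker_add_kronecker_eq_of_mul_eq_mul {R ι κ : Type*} [CommRing R]
    [Fintype ι] [DecidableEq ι] [Fintype κ] [DecidableEq κ] {G T P : Matrix ι ι R}
    (hP : IsUnit P.det) (h : G * P = P * T) (B C : Matrix κ κ R) :
    ((1 : Matrix ι ι R) ⊗ₖ B + G ⊗ₖ C).det = ((1 : Matrix ι ι R) ⊗ₖ B + T ⊗ₖ C).det := by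
  have hu : IsUnit (P ⊗ₖ (1 : Matrix κ κ R)).det := by
    rw [det_kronecker, det_one, one_pow, mul_one]
    exact hP.pow _
  have hmul : ((1 : Matrix ι ι R) ⊗ₖ B + G ⊗ₖ C) * (P ⊗ₖ (1 : Matrix κ κ R)) =
      (P ⊗ₖ (1 : Matrix κ κ R)) * ((1 : Matrix ι ι R) ⊗ₖ B + T ⊗ₖ C) := by
    simp only [add_mul, mul_add, ← mul_kronecker_mul, h, one_mul, mul_one]
  have hdet := congrArg det hmul
  rw [det_mul, det_mul, mul_comm] at hdet
  exact hu.mul_left_cancel hdet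

/-- A triangular matrix similar to `GamD (m * 2)`. The index `(k, 0)` stands for the sum of the
basis vectors of the `k`-th pair of consecutive indices, `(k, 1)` for the second of them. -/
def gamDTriangular (m : ℕ) : Matrix (Fin m × Fin 2) (Fin m × Fin 2) ℝ :=
  Matrix.of fun p q =>
    (if p.2 = 0 then (if q.2 = 0 then (if p.1 ≤ q.1 then 2 else 0) else 1) else 0) -
      (if p = q then 2 * (m : ℝ) - 2 * (p.1 : ℕ) else 0)

theorem gamDTriangular_blockTriangular (m : ℕ) :
    (gamDTriangular m).BlockTriangular
      ((Equiv.prodComm (Fin m) (Fin 2)).trans (toLex : Fin 2 × Fin m ≃ Fin 2 ×ₗ Fin m)) := by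
  rintro ⟨k, a⟩ ⟨l, c⟩ h
  have h' : c < a ∨ c = a ∧ l < k := by simpa [Prod.Lex.toLex_lt_toLex] using h
  rcases h' with h' | ⟨rfl, h'⟩
  · have ha : a ≠ 0 := by rintro rfl; exact absurd h' (by simp)
    simp [gamDTriangular, h'.ne', ha]
  · fin_cases c <;> simp [gamDTriangular, h'.ne', h'.not_ge]

theorem sum_GamDOff (m : ℕ) (i : Fin (m * 2)) :
    ∑ j, GamDOff (m * 2) i j = 2 * (m : ℝ) - 2 * (i.1 / 2 : ℕ) := by
  rw [← finProdFinEquiv.sum_comp, Fintype.sum_prod_type]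
  have hk : i.1 / 2 < m := by omega
  have hpair : ∀ l : Fin m, ∑ c : Fin 2, GamDOff (m * 2) i (finProdFinEquiv (l, c)) =
      2 - if l < (⟨i.1 / 2, hk⟩ : Fin m) then 2 else 0 := by
    intro l
    have hcond : (2 * l.1 + 2 ≤ i.1) ↔ l < (⟨i.1 / 2, hk⟩ : Fin m) := by
      rw [Fin.lt_def]
      dsimp only
      omega
    have hodd : (1 + 2 * l.1) % 2 ≠ 0 := by omega
    simp only [Fin.sum_univ_two, GamDOff, finProdFinEquiv_apply_val, Fin.val_zero, Fin.val_one,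
      zero_add, Nat.mul_mod_right, hcond, hodd, and_true, and_false, if_false]
    split_ifs <;> norm_num
  simp only [hpair, Finset.sum_sub_distrib, ← Finset.sum_filter, Finset.sum_const]
  simp [Finset.filter_gt_eq_Iio, mul_comm]

theorem GamD_apply_finProdFinEquiv (m : ℕ) (p q : Fin m × Fin 2) :
    GamD (m * 2) (finProdFinEquiv p) (finProdFinEquiv q) =
      (if q.1 < p.1 ∧ q.2 = 0 then -1 else 1) -
        (if p = q then 2 * (m : ℝ) - 2 * (p.1 : ℕ) else 0) := by
  obtain ⟨k, a⟩ := p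
  obtain ⟨l, c⟩ := q
  have hoff : GamDOff (m * 2) (finProdFinEquiv (k, a)) (finProdFinEquiv (l, c)) =
      if l < k ∧ c = 0 then -1 else 1 := by
    simp only [GamDOff, finProdFinEquiv_apply_val, Fin.lt_def, Fin.ext_iff, Fin.val_zero]
    congr 1
    have := a.2
    have := c.2
    exact propext (by omega)
  by_cases h : (k, a) = (l, c)
  · obtain ⟨rfl, rfl⟩ := Prod.mk.inj h
    have hdiv : (finProdFinEquiv (k, a)).1 / 2 = k.1 := by
      have := a.2
      simp only [finProdFinEquiv_apply_val]
      omega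
    have hsum := sum_GamDOff m (finProdFinEquiv (k, a))
    rw [hdiv, ← Finset.sum_sdiff (Finset.subset_univ {finProdFinEquiv (k, a)}),
      Finset.sum_singleton, hoff] at hsum
    simp only [lt_irrefl, false_and, if_false] at hsum
    simp only [GamD, of_apply, if_true, lt_irrefl, false_and, if_false]
    linarith
  · simp [GamD, h, hoff]

/-- The change of basis between `GamD (m * 2)` and `gamDTriangular m`. -/
theorem GamD_submatrix_mul_eq (m : ℕ) :
    (GamD (m * 2)).submatrix finProdFinEquiv finProdFinEquiv *
        ((1 : Matrix (Fin m) (Fin m) ℝ) ⊗ₖ !![1, 0; 1, 1]) =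
      ((1 : Matrix (Fin m) (Fin m) ℝ) ⊗ₖ !![1, 0; 1, 1]) * gamDTriangular m := by
  ext ⟨k, a⟩ ⟨l, c⟩
  simp only [mul_apply, Fintype.sum_prod_type, submatrix_apply, GamD_apply_finProdFinEquiv,
    gamDTriangular, kroneckerMap_apply, one_apply, Fin.sum_univ_two, of_apply]
  rcases lt_trichotomy k l with h | rfl | h
  · fin_cases a <;> fin_cases c <;>
      simp [Finset.sum_add_distrib, h.ne, h.le, h.not_gt] <;> norm_num
  · fin_cases a <;> fin_cases c <;>
      simp [Finset.sum_add_distrib] <;> ring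
  · fin_cases a <;> fin_cases c <;>
      simp [Finset.sum_add_distrib, h.ne', h.not_ge, h]

theorem mem_spectrum_iff_det_eq_zero {K ι : Type*} [Field K] [Fintype ι] [DecidableEq ι]
    (M : Matrix ι ι K) (μ : K) : μ ∈ spectrum K M ↔ (μ • (1 : Matrix ι ι K) - M).det = 0 := by
  rw [spectrum.mem_iff, isUnit_iff_isUnit_det, isUnit_iff_ne_zero, not_not,
    Algebra.algebraMap_eq_smul_one]

theorem mem_spectrum_one_kronecker_add_GamD_kronecker_iff {κ : Type*} [Fintype κ] [DecidableEq κ]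
    (m : ℕ) (A B : Matrix κ κ ℝ) (μ : ℂ) :
    μ ∈ spectrum ℂ
        (((1 : Matrix (Fin (m * 2)) (Fin (m * 2)) ℝ) ⊗ₖ A + GamD (m * 2) ⊗ₖ B).map
          Complex.ofReal) ↔
      ∃ p, μ ∈ spectrum ℂ ((A + gamDTriangular m p p • B).map Complex.ofReal) := by
  have hP : IsUnit (((1 : Matrix (Fin m) (Fin m) ℝ) ⊗ₖ !![1, 0; 1, 1]).map
      Complex.ofReal).det := by
    have h1 : ((1 : Matrix (Fin m) (Fin m) ℝ) ⊗ₖ !![(1 : ℝ), 0; 1, 1]).det = 1 := by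
      simp [det_kronecker]
    have h2 := Complex.ofRealHom.map_det
      ((1 : Matrix (Fin m) (Fin m) ℝ) ⊗ₖ !![(1 : ℝ), 0; 1, 1])
    rw [h1, map_one] at h2
    exact h2 ▸ isUnit_one
  have hsim :
      ((GamD (m * 2)).submatrix finProdFinEquiv finProdFinEquiv).map Complex.ofReal *
          ((1 : Matrix (Fin m) (Fin m) ℝ) ⊗ₖ !![1, 0; 1, 1]).map Complex.ofReal =
        ((1 : Matrix (Fin m) (Fin m) ℝ) ⊗ₖ !![1, 0; 1, 1]).map Complex.ofReal *
          (gamDTriangular m).map Complex.ofReal := by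
    have h := congrArg Complex.ofRealHom.mapMatrix (GamD_submatrix_mul_eq m)
    rwa [map_mul, map_mul] at h
  have htri : ((gamDTriangular m).map Complex.ofReal).BlockTriangular
      ((Equiv.prodComm (Fin m) (Fin 2)).trans (toLex : Fin 2 × Fin m ≃ Fin 2 ×ₗ Fin m)) := by
    intro p q h
    simp [gamDTriangular_blockTriangular m h]
  have hreindex : (μ • (1 : Matrix (Fin (m * 2) × κ) (Fin (m * 2) × κ) ℂ) -
      ((1 : Matrix (Fin (m * 2)) (Fin (m * 2)) ℝ) ⊗ₖ A + GamD (m * 2) ⊗ₖ B).map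
        Complex.ofReal).submatrix (finProdFinEquiv.prodCongr (Equiv.refl κ))
          (finProdFinEquiv.prodCongr (Equiv.refl κ)) =
      (1 : Matrix (Fin m × Fin 2) (Fin m × Fin 2) ℂ) ⊗ₖ
          (μ • (1 : Matrix κ κ ℂ) - A.map Complex.ofReal) +
        ((GamD (m * 2)).submatrix finProdFinEquiv finProdFinEquiv).map Complex.ofReal ⊗ₖ
          (-B.map Complex.ofReal) := by
    ext ⟨p, x⟩ ⟨q, y⟩
    by_cases hpq : p = q <;> by_cases hxy : x = y <;>
      simp [one_apply, hpq, hxy] <;> ring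
  rw [mem_spectrum_iff_det_eq_zero,
    ← det_submatrix_equiv_self (finProdFinEquiv.prodCongr (Equiv.refl κ)), hreindex,
    det_one_kronecker_add_kronecker_eq_of_mul_eq_mul hP hsim,
    det_one_kronecker_add_kronecker_of_blockTriangular _ htri, Finset.prod_eq_zero_iff]
  simp only [Finset.mem_univ, true_and, mem_spectrum_iff_det_eq_zero]
  refine exists_congr fun p => ?_
  have hblock : μ • (1 : Matrix κ κ ℂ) - A.map Complex.ofReal +
      (gamDTriangular m).map Complex.ofReal p p • (-B.map Complex.ofReal) =
      μ • (1 : Matrix κ κ ℂ) - (A + gamDTriangular m p p • B).map Complex.ofReal := by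
    ext x y
    simp
    ring
  rw [hblock]

theorem gamDTriangular_diag_fst (m : ℕ) (k : Fin m) :
    gamDTriangular m (k, 0) (k, 0) = -(2 * (m - 1 - k : ℕ) : ℕ) := by
  have h : ((m - 1 - k : ℕ) : ℝ) = m - 1 - (k : ℕ) := by
    rw [Nat.sub_sub, Nat.cast_sub (by omega)]
    push_cast
    ring
  simp [gamDTriangular, h]
  ring

theorem gamDTriangular_diag_snd (m : ℕ) (k : Fin m) :
    gamDTriangular m (k, 1) (k, 1) = -(2 * (m - k : ℕ) : ℕ) := by
  simp [gamDTriangular, Nat.cast_sub k.2.le]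
  ring

/-- For even `N ≥ 2`, `I_N ⊗ A1 + Γ_D ⊗ A12` is Hurwitz iff `A1 − m·A12` is Hurwitz for
`m = 0` and every even `m` with `2 ≤ m ≤ N`. -/
theorem diffusive_network_hurwitz_iff_even (N n : ℕ) (hN : 2 ≤ N) (hNe : Even N)
    (A1 A12 : Matrix (Fin n) (Fin n) ℝ) :
    IsHurwitz ((1 : Matrix (Fin N) (Fin N) ℝ) ⊗ₖ A1 + GamD N ⊗ₖ A12) ↔
      (IsHurwitz A1 ∧
        ∀ m : ℕ, Even m → 2 ≤ m → m ≤ N → IsHurwitz (A1 - (m : ℝ) • A12)) := by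
  obtain ⟨m, hm⟩ := hNe
  obtain rfl : N = m * 2 := by omega
  have hfst (k : Fin m) : A1 + gamDTriangular m (k, 0) (k, 0) • A12 =
      A1 - ((2 * (m - 1 - k : ℕ) : ℕ) : ℝ) • A12 := by
    rw [gamDTriangular_diag_fst, neg_smul, sub_eq_add_neg]
  have hsnd (k : Fin m) : A1 + gamDTriangular m (k, 1) (k, 1) • A12 =
      A1 - ((2 * (m - k : ℕ) : ℕ) : ℝ) • A12 := by
    rw [gamDTriangular_diag_snd, neg_smul, sub_eq_add_neg]
  have key : IsHurwitz ((1 : Matrix (Fin (m * 2)) (Fin (m * 2)) ℝ) ⊗ₖ A1 +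
      GamD (m * 2) ⊗ₖ A12) ↔ ∀ p, IsHurwitz (A1 + gamDTriangular m p p • A12) := by
    simp only [IsHurwitz, mem_spectrum_one_kronecker_add_GamD_kronecker_iff, forall_exists_index]
    exact forall_comm
  rw [key]
  constructor
  · intro h
    refine ⟨?_, fun j hj hj2 hjN => ?_⟩
    · have h0 := h (⟨m - 1, by omega⟩, 0)
      rw [hfst] at h0
      simpa using h0
    · obtain ⟨r, hr⟩ := hj
      have hj' := h (⟨m - r, by omega⟩, 1)
      rw [hsnd] at hj'
      have hjr : 2 * (m - (m - r)) = j := by omega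
      simpa only [hjr] using hj'
  · rintro ⟨h0, h⟩ ⟨k, c⟩
    fin_cases c
    · change IsHurwitz (A1 + gamDTriangular m (k, 0) (k, 0) • A12)
      rw [hfst]
      rcases Nat.eq_zero_or_pos (m - 1 - k) with hk | hk
      · simpa [hk] using h0
      · exact h _ (even_two_mul _) (by omega) (by omega)
    · change IsHurwitz (A1 + gamDTriangular m (k, 1) (k, 1) • A12)
      rw [hsnd]
      exact h _ (even_two_mul _) (by omega) (by omega)
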